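/- arXiv:2405.17200 — 4 statements merged into one kernel-verified Lean document; each statement's English description precedes it below -/
import Mathlib

section
/- Let H be a complex inner product space and let M : H → H be a continuous linear map that is symmetric, i.e. ⟪M u, w⟫ = ⟪u, M w⟫ for all u, w ∈ H. Let v : ℝ → H be differentiable at π with ‖v(κ)‖ = 1 for every κ ∈ ℝ, and let c : ℝ → ℂ be a function such that M(v(κ)) = c(κ) • v(2π − κ) for every κ ∈ ℝ. Assume M(v(π)) = −v(π) and Im ⟪v′(π), v(π)⟫ = 0, where v′(π) denotes the derivative of v at π. Then M(v′(π)) = v′(π). -/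
open scoped ComplexInnerProductSpace

/-- Proposition 4.1 of the paper, abstract form.
Let `M` be a continuous linear symmetric operator on a complex inner product space,
`v : ℝ → H` a family of unit vectors differentiable at `π` with derivative `vd`,
and `c : ℝ → ℂ` with `M (v κ) = c κ • v (2π − κ)` for all `κ`.
If `M (v π) = -v π` and the gauge condition `Im ⟪v'(π), v(π)⟫ = 0` holds, then
`M (v'(π)) = v'(π)`.
The paper's inner product `⟪u, w⟫` (linear in the first argument) corresponds to
Mathlib's `⟪w, u⟫`; in particular the paper's `⟪v'(π), v(π)⟫` is `⟪v π, vd⟫` below. -/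
theorem parity_of_momentum_derivative
    {H : Type*} [NormedAddCommGroup H] [InnerProductSpace ℂ H]
    (M : H →L[ℂ] H)
    (hsym : ∀ u w : H, ⟪w, M u⟫ = ⟪M w, u⟫)
    (v : ℝ → H) (vd : H) (hv : HasDerivAt v vd Real.pi)
    (hnorm : ∀ κ : ℝ, ‖v κ‖ = 1)
    (c : ℝ → ℂ)
    (hc : ∀ κ : ℝ, M (v κ) = c κ • v (2 * Real.pi - κ))
    (hMπ : M (v Real.pi) = -v Real.pi)
    (hgauge : (⟪v Real.pi, vd⟫).im = 0) :
    M vd = vd := by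
  have hone : ⟪v Real.pi, v Real.pi⟫ = 1 := by
    rw [inner_self_eq_norm_sq_to_K, hnorm]; simp
  have hre : (⟪v Real.pi, vd⟫).re = 0 := by
    have h1 := HasDerivAt.inner ℂ hv hv
    have h2 : (fun t => ⟪v t, v t⟫) = fun _ => (1 : ℂ) := by
      funext t
      rw [inner_self_eq_norm_sq_to_K, hnorm]; simp
    rw [h2] at h1
    have h3 := h1.unique (hasDerivAt_const Real.pi (1 : ℂ))
    rw [← inner_conj_symm vd (v Real.pi)] at h3
    have h4 := congrArg Complex.re h3
    simp only [Complex.add_re, Complex.conj_re, Complex.zero_re] at h4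
    linarith
  have ha : ⟪v Real.pi, vd⟫ = 0 := Complex.ext hre hgauge
  have hf : HasDerivAt (fun t => ⟪v Real.pi, v t⟫) 0 Real.pi := by
    have h := HasDerivAt.inner ℂ (hasDerivAt_const Real.pi (v Real.pi)) hv
    simpa [ha] using h
  have hpi : 2 * Real.pi - Real.pi = Real.pi := by ring
  have hr : HasDerivAt (fun t : ℝ => 2 * Real.pi - t) (-1) Real.pi := by
    simpa using (hasDerivAt_id Real.pi).const_sub (2 * Real.pi)
  have hvr : HasDerivAt (fun t => v (2 * Real.pi - t)) (-vd) Real.pi := by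
    have h := HasDerivAt.scomp (h := fun t : ℝ => 2 * Real.pi - t) Real.pi
      (by rw [hpi]; exact hv) hr
    simpa [Function.comp_def] using h
  have hfr : HasDerivAt (fun t => ⟪v Real.pi, v (2 * Real.pi - t)⟫) 0 Real.pi := by
    have h := HasDerivAt.inner ℂ (hasDerivAt_const Real.pi (v Real.pi)) hvr
    simpa [ha] using h
  have hM : HasDerivAt (fun t => M (v t)) (M vd) Real.pi :=
    (M.restrictScalars ℝ).hasFDerivAt.comp_hasDerivAt Real.pi hv
  have hL := hfr.smul hM
  have hR := hf.neg.smul hvr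
  have heq : (fun t => ⟪v Real.pi, v (2 * Real.pi - t)⟫ • M (v t)) =
      fun t => (-⟪v Real.pi, v t⟫) • v (2 * Real.pi - t) := by
    funext t
    have h : ⟪v Real.pi, M (v t)⟫ = -⟪v Real.pi, v t⟫ := by
      rw [hsym, hMπ, inner_neg_left]
    rw [← h, hc t, inner_smul_right, smul_smul, mul_comm]
  have hL' : HasDerivAt (fun t => ⟪v Real.pi, v (2 * Real.pi - t)⟫ • M (v t)) (M vd) Real.pi := by
    convert hL using 1
    · rfl
    · simp [hpi, hnorm]
  have hR' : HasDerivAt (fun t => (-⟪v Real.pi, v t⟫) • v (2 * Real.pi - t)) vd Real.pi := by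
    convert hR using 1
    · rfl
    · simp [hpi, hnorm]
  rw [heq] at hL'
  exact hL'.unique hR'
end

section
/- Let H be a complex inner product space and let M : H → H be a continuous linear map that is symmetric, i.e. ⟪M u, w⟫ = ⟪u, M w⟫ for all u, w ∈ H. Let v : ℝ → H be differentiable at π with ‖v(κ)‖ = 1 for every κ ∈ ℝ, and let c : ℝ → ℂ be a function such that M(v(κ)) = c(κ) • v(2π − κ) for every κ ∈ ℝ. Assume M(v(π)) = −v(π). Then c(κ) = ⟪M(v(κ)), v(2π − κ)⟫ for all κ, c is differentiable at π, and its derivative satisfies c′(π) = −2i · Im ⟪v′(π), v(π)⟫, where v′(π) is the derivative of v at π. -/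
open scoped ComplexInnerProductSpace

/-- key differentiation identity inside Proposition 4.1 of the paper.
Let `M` be a continuous linear symmetric operator on a complex inner product space,
`v : ℝ → H` a family of unit vectors differentiable at `π` with derivative `vd`,
and `c : ℝ → ℂ` with `M (v κ) = c κ • v (2π − κ)` for all `κ` and `M (v π) = -v π`.
Then `c κ = ⟪M (v κ), v (2π − κ)⟫` for all `κ`, and `c` is differentiable at `π` with
derivative `c'(π) = -2 i Im ⟪v'(π), v(π)⟫`.
The paper's inner product `⟪u, w⟫` (linear in the first argument) corresponds to
Mathlib's `⟪w, u⟫`; in particular the paper's `⟪M (v κ), v (2π − κ)⟫` is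
`⟪v (2π − κ), M (v κ)⟫` below and `⟪v'(π), v(π)⟫` is `⟪v π, vd⟫`. -/
theorem phase_function_derivative
    {H : Type*} [NormedAddCommGroup H] [InnerProductSpace ℂ H]
    (M : H →L[ℂ] H)
    (hsym : ∀ u w : H, ⟪w, M u⟫ = ⟪M w, u⟫)
    (v : ℝ → H) (vd : H) (hv : HasDerivAt v vd Real.pi)
    (hnorm : ∀ κ : ℝ, ‖v κ‖ = 1)
    (c : ℝ → ℂ)
    (hc : ∀ κ : ℝ, M (v κ) = c κ • v (2 * Real.pi - κ))
    (hMπ : M (v Real.pi) = -v Real.pi) :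
    (∀ κ : ℝ, c κ = ⟪v (2 * Real.pi - κ), M (v κ)⟫) ∧
    HasDerivAt c (-2 * Complex.I * ((⟪v Real.pi, vd⟫).im : ℂ)) Real.pi := by
  have h1 : ∀ κ : ℝ, c κ = ⟪v (2 * Real.pi - κ), M (v κ)⟫ := by
    intro κ
    rw [hc κ, inner_smul_right, inner_self_eq_norm_sq_to_K, hnorm]
    simp
  refine ⟨h1, ?_⟩
  have hpi : 2 * Real.pi - Real.pi = Real.pi := by ring
  have hM : HasDerivAt (fun κ => M (v κ)) (M vd) Real.pi :=
    (M.restrictScalars ℝ).hasFDerivAt.comp_hasDerivAt Real.pi hv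
  have hr : HasDerivAt (fun κ => v (2 * Real.pi - κ)) (-vd) Real.pi := by
    have := HasDerivAt.comp_const_sub (f := v) (f' := vd) (2 * Real.pi) Real.pi (by rwa [hpi])
    exact this
  have h2 := hr.inner ℂ hM
  rw [hpi] at h2
  have hfun : c = fun κ => ⟪v (2 * Real.pi - κ), M (v κ)⟫ := funext h1
  rw [hfun]
  have h3 : -2 * Complex.I * ((⟪v Real.pi, vd⟫).im : ℂ)
      = ⟪v Real.pi, M vd⟫ + ⟪-vd, M (v Real.pi)⟫ := by
    rw [hsym vd, hMπ, inner_neg_neg, inner_neg_left, ← inner_conj_symm vd (v Real.pi)]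
    generalize ⟪v Real.pi, vd⟫ = z
    apply Complex.ext
    · simp
    · simp
      ring
  rw [h3]
  exact h2
end

section
/- Let R : ℝ² → ℝ² be the rotation R(x₁,x₂) = (−x₂, x₁) and let Y = [−1/2, 1/2] × [−1/2, 1/2]. Let b : ℝ² → ℝ be a bounded measurable function with b(R x) = b(x) for all x ∈ ℝ², and let v₁, v₂ : ℝ² → ℂ be continuously differentiable functions with v₁(R x) = i·v₂(x) and v₂(R x) = i·v₁(x) for all x ∈ ℝ². For a differentiable f : ℝ² → ℂ write ∇f(x) = (∂₁f(x), ∂₂f(x)) ∈ ℂ², and for w = (w₁,w₂) ∈ ℂ² let σ₂ w := (−i·w₂, i·w₁). Then ∫_Y b(x)·⟨σ₂ ∇v₁(x), ∇v₂(x)⟩ dx = ∫_Y b(x)·⟨σ₂ ∇v₂(x), ∇v₁(x)⟩ dx, where ⟨u, w⟩ := u₁·conj(w₁) + u₂·conj(w₂). -/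
open MeasureTheory

/-- The π/2-rotation `R(x₁,x₂) = (−x₂, x₁)` of `ℝ²`. -/
def Rrot (x : ℝ × ℝ) : ℝ × ℝ := (-x.2, x.1)

/-- The unit cell `Y = [−1/2, 1/2] × [−1/2, 1/2]`. -/
def Ycell : Set (ℝ × ℝ) := Set.Icc (-(1:ℝ)/2) (1/2) ×ˢ Set.Icc (-(1:ℝ)/2) (1/2)

/-- The gradient `∇f(x) = (∂₁ f(x), ∂₂ f(x)) ∈ ℂ²` of a function `f : ℝ² → ℂ`. -/
noncomputable def grad2 (f : ℝ × ℝ → ℂ) (x : ℝ × ℝ) : ℂ × ℂ :=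
  (fderiv ℝ f x (1, 0), fderiv ℝ f x (0, 1))

/-- The Pauli matrix `σ₂ = [[0, −i], [i, 0]]` acting on `ℂ²`:
`σ₂ (w₁, w₂) = (−i·w₂, i·w₁)`. -/
def sigma2 (w : ℂ × ℂ) : ℂ × ℂ := (-Complex.I * w.2, Complex.I * w.1)

/-- The Hermitian pairing `⟨u, w⟩ = u₁·conj(w₁) + u₂·conj(w₂)` on `ℂ²`. -/
def cdot (u w : ℂ × ℂ) : ℂ := u.1 * (starRingEnd ℂ) w.1 + u.2 * (starRingEnd ℂ) w.2

/-- identity (B.1) in the proof of Lemma 7.3 of the paper.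
If `b` is bounded, measurable and rotation-invariant, and `v₁, v₂` are `C¹` functions with
`v₁(Rx) = i·v₂(x)` and `v₂(Rx) = i·v₁(x)`, then
`∫_Y b·⟨σ₂ ∇v₁, ∇v₂⟩ = ∫_Y b·⟨σ₂ ∇v₂, ∇v₁⟩`. -/
theorem offdiagonal_elements_equal
    (b : ℝ × ℝ → ℝ) (hbm : Measurable b) (hbb : ∃ C, ∀ x, |b x| ≤ C)
    (hbR : ∀ x, b (Rrot x) = b x)
    (v₁ v₂ : ℝ × ℝ → ℂ) (hv₁ : ContDiff ℝ 1 v₁) (hv₂ : ContDiff ℝ 1 v₂)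
    (hv₁R : ∀ x, v₁ (Rrot x) = Complex.I * v₂ x)
    (hv₂R : ∀ x, v₂ (Rrot x) = Complex.I * v₁ x) :
    ∫ x in Ycell, (b x : ℂ) * cdot (sigma2 (grad2 v₁ x)) (grad2 v₂ x) =
      ∫ x in Ycell, (b x : ℂ) * cdot (sigma2 (grad2 v₂ x)) (grad2 v₁ x) := by
  have key : ∀ u w : ℝ × ℝ → ℂ, ContDiff ℝ 1 u → ContDiff ℝ 1 w →
      (∀ x, u (Rrot x) = Complex.I * w x) → ∀ x,
      grad2 u (Rrot x) = (-Complex.I * (grad2 w x).2, Complex.I * (grad2 w x).1) := by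
    intro u w hu hw h x
    let L : ℝ × ℝ →L[ℝ] ℝ × ℝ :=
      (-(ContinuousLinearMap.snd ℝ ℝ ℝ)).prod (ContinuousLinearMap.fst ℝ ℝ ℝ)
    have hL : ∀ y, L y = Rrot y := fun y => by simp [L, Rrot]
    have h1 : HasFDerivAt (fun y => u (L y)) ((fderiv ℝ u (L x)).comp L) x :=
      ((hu.differentiable (by norm_num)) (L x)).hasFDerivAt.comp x L.hasFDerivAt
    have h2 : HasFDerivAt (fun y => Complex.I * w y) (Complex.I • fderiv ℝ w x) x :=
      ((hw.differentiable (by norm_num)) x).hasFDerivAt.const_mul Complex.I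
    have h3 : (fun y => u (L y)) = fun y => Complex.I * w y := by
      funext y; rw [hL, h]
    rw [h3] at h1
    have h4 := h1.unique h2
    rw [hL] at h4
    have e1 := congrArg (fun T => T ((1, 0) : ℝ × ℝ)) h4
    have e2 := congrArg (fun T => T ((0, 1) : ℝ × ℝ)) h4
    have q1 : L (1, 0) = (0, 1) := by simp [hL, Rrot]
    have q2 : L (0, 1) = -(1, 0) := by simp [hL, Rrot]
    simp only [ContinuousLinearMap.comp_apply, q1, q2, map_neg,
      ContinuousLinearMap.smul_apply, smul_eq_mul] at e1 e2
    ext1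
    · simp only [grad2]; linear_combination -e2
    · simp only [grad2]; exact e1
  let e : ℝ × ℝ ≃ᵐ ℝ × ℝ :=
    MeasurableEquiv.prodComm.trans ((MeasurableEquiv.neg ℝ).prodCongr (MeasurableEquiv.refl ℝ))
  have he : ∀ x, e x = Rrot x := fun x => rfl
  have hmp : MeasurePreserving e (volume : Measure (ℝ × ℝ)) volume := by
    have a : MeasurePreserving (Prod.map (fun t : ℝ => -t) (fun t : ℝ => t))
        ((volume : Measure ℝ).prod (volume : Measure ℝ)) (volume.prod volume) :=
      (Measure.measurePreserving_neg (volume : Measure ℝ)).prod (MeasurePreserving.id volume)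
    exact a.comp (Measure.measurePreserving_swap)
  have hpre : e ⁻¹' Ycell = Ycell := by
    ext x
    simp only [Set.mem_preimage, he, Rrot, Ycell, Set.mem_prod, Set.mem_Icc]
    constructor
    · rintro ⟨⟨_, _⟩, _, _⟩; refine ⟨⟨?_, ?_⟩, ?_, ?_⟩ <;> linarith
    · rintro ⟨⟨_, _⟩, _, _⟩; refine ⟨⟨?_, ?_⟩, ?_, ?_⟩ <;> linarith
  rw [← hmp.setIntegral_preimage_emb e.measurableEmbedding, hpre]
  congr 1
  funext x
  rw [he, hbR, key v₁ v₂ hv₁ hv₂ hv₁R, key v₂ v₁ hv₂ hv₁ hv₂R]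
  simp only [cdot, sigma2, map_mul, map_neg, Complex.conj_I]
  ring_nf
  simp only [Complex.I_sq, Complex.I_pow_three]
  ring
end

section
/- Let R : ℝ² → ℝ² be the rotation R(x₁,x₂) = (−x₂, x₁) and let Y = [−1/2, 1/2] × [−1/2, 1/2]. Let b : ℝ² → ℝ be a bounded measurable function with b(R x) = b(x) for all x ∈ ℝ², and let v₁, v₂ : ℝ² → ℂ be continuously differentiable functions with v₁(R x) = i·v₂(x) and v₂(R x) = i·v₁(x) for all x ∈ ℝ². For a differentiable f : ℝ² → ℂ write ∇f(x) = (∂₁f(x), ∂₂f(x)) ∈ ℂ², and for w = (w₁,w₂) ∈ ℂ² let σ₂ w := (−i·w₂, i·w₁). Then the complex number ∫_Y b(x)·⟨σ₂ ∇v₁(x), ∇v₂(x)⟩ dx, where ⟨u, w⟩ := u₁·conj(w₁) + u₂·conj(w₂), is real. -/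
open MeasureTheory

theorem Rrot_grad (f g : ℝ × ℝ → ℂ) (hf : ContDiff ℝ 1 f) (hg : ContDiff ℝ 1 g)
    (h : ∀ x, f (Rrot x) = Complex.I * g x) (x : ℝ × ℝ) :
    grad2 f (Rrot x) = (-Complex.I * (grad2 g x).2, Complex.I * (grad2 g x).1) := by
  let L : ℝ × ℝ →L[ℝ] ℝ × ℝ :=
    (-(ContinuousLinearMap.snd ℝ ℝ ℝ)).prod (ContinuousLinearMap.fst ℝ ℝ ℝ)
  have hL : HasFDerivAt Rrot L x := L.hasFDerivAt
  have h1 : HasFDerivAt (fun y => f (Rrot y)) ((fderiv ℝ f (Rrot x)).comp L) x :=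
    ((hf.differentiable one_ne_zero) (Rrot x)).hasFDerivAt.comp x hL
  have h2 : HasFDerivAt (fun y => Complex.I * g y) (Complex.I • fderiv ℝ g x) x :=
    ((hg.differentiable one_ne_zero) x).hasFDerivAt.const_mul Complex.I
  have h3 : (fun y => f (Rrot y)) = fun y => Complex.I * g y := funext h
  rw [h3] at h1
  have h4 := h1.unique h2
  have e1 := congrArg (fun T => T (1, 0)) h4
  have e2 := congrArg (fun T => T (0, 1)) h4
  simp [L] at e1 e2
  have e3 : ((-1 : ℝ), (0 : ℝ)) = -((1 : ℝ), (0 : ℝ)) := by simp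
  rw [e3, map_neg] at e2
  ext1
  · simp only [grad2]
    linear_combination -e2
  · simp only [grad2]
    exact e1

theorem Rrot_mp : MeasurePreserving Rrot (volume : Measure (ℝ × ℝ)) volume := by
  have h1 : MeasurePreserving (Prod.swap : ℝ × ℝ → ℝ × ℝ) volume volume :=
    Measure.measurePreserving_swap
  have h2 : MeasurePreserving (Prod.map (fun t : ℝ => -t) (id : ℝ → ℝ))
      (volume : Measure (ℝ × ℝ)) volume :=
    (Measure.measurePreserving_neg (volume : Measure ℝ)).prod (MeasurePreserving.id volume)
  exact h2.comp h1

theorem Rrot_emb : MeasurableEmbedding Rrot := by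
  let e : (ℝ × ℝ) ≃ᵐ (ℝ × ℝ) :=
    { toFun := Rrot
      invFun := fun x => (x.2, -x.1)
      left_inv := fun x => by simp [Rrot]
      right_inv := fun x => by simp [Rrot]
      measurable_toFun := Rrot_mp.measurable
      measurable_invFun := by
        change Measurable (fun x : ℝ × ℝ => (x.2, -x.1))
        fun_prop }
  exact e.measurableEmbedding

theorem Rrot_pre : Rrot ⁻¹' Ycell = Ycell := by
  ext x
  simp only [Ycell, Rrot, Set.mem_preimage, Set.mem_prod, Set.mem_Icc]
  constructor <;> rintro ⟨⟨_, _⟩, _, _⟩ <;> refine ⟨⟨?_, ?_⟩, ?_, ?_⟩ <;> linarith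

/-- identity (B.2) in the proof of Lemma 7.3 of the paper.
If `b` is bounded, measurable and rotation-invariant, and `v₁, v₂` are `C¹` functions with
`v₁(Rx) = i·v₂(x)` and `v₂(Rx) = i·v₁(x)`, then the complex number
`∫_Y b·⟨σ₂ ∇v₁, ∇v₂⟩` is real. -/
theorem offdiagonal_element_real
    (b : ℝ × ℝ → ℝ) (hbm : Measurable b) (hbb : ∃ C, ∀ x, |b x| ≤ C)
    (hbR : ∀ x, b (Rrot x) = b x)
    (v₁ v₂ : ℝ × ℝ → ℂ) (hv₁ : ContDiff ℝ 1 v₁) (hv₂ : ContDiff ℝ 1 v₂)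
    (hv₁R : ∀ x, v₁ (Rrot x) = Complex.I * v₂ x)
    (hv₂R : ∀ x, v₂ (Rrot x) = Complex.I * v₁ x) :
    (∫ x in Ycell, (b x : ℂ) * cdot (sigma2 (grad2 v₁ x)) (grad2 v₂ x)).im = 0 := by
  have hF : ∀ x, (b (Rrot x) : ℂ) * cdot (sigma2 (grad2 v₁ (Rrot x))) (grad2 v₂ (Rrot x))
      = (starRingEnd ℂ) ((b x : ℂ) * cdot (sigma2 (grad2 v₁ x)) (grad2 v₂ x)) := by
    intro x
    rw [hbR, Rrot_grad v₁ v₂ hv₁ hv₂ hv₁R, Rrot_grad v₂ v₁ hv₂ hv₁ hv₂R]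
    simp only [cdot, sigma2, map_mul, map_add, map_neg, Complex.conj_I, Complex.conj_ofReal,
      Complex.conj_conj]
    ring_nf
    simp only [Complex.I_sq, Complex.I_pow_three]
    ring
  have key := Rrot_mp.setIntegral_preimage_emb Rrot_emb
    (fun x => (b x : ℂ) * cdot (sigma2 (grad2 v₁ x)) (grad2 v₂ x)) Ycell
  rw [Rrot_pre] at key
  simp only [hF] at key
  rw [integral_conj] at key
  exact Complex.conj_eq_iff_im.mp key
end
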